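/- Let q > 1 and let I, J be a bipartition of Z_q. With n = 7 and k = 5 (so t = 2), the cardinality of U_{I,J}^{(2)}(7) equals |I|^3 |J|^2 (q^2 - |I|^2). -/

import Mathlib

open List

/-- A code (set of words) is cross-bifix-free: no proper nonempty prefix of a
codeword equals a proper nonempty suffix of a codeword. -/
def IsCBF {α : Type*} (C : Set (List α)) : Prop :=
  ∀ u ∈ C, ∀ v ∈ C, ∀ w : List α, w ≠ [] → w.length < u.length → w.length < v.length →
    ¬ (w <+: u ∧ w <:+ v)

/-- A word is bifix-free: no proper nonempty prefix equals a proper nonempty suffix. -/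
def BifixFree {α : Type*} (u : List α) : Prop :=
  ∀ w : List α, w ≠ [] → w.length < u.length → w <+: u → ¬ w <:+ u

/-- `w` is `I^k`-free: no `k` consecutive coordinates of `w` all lie in `I`. -/
def IkFree {α : Type*} (I : Set α) (k : ℕ) (w : List α) : Prop :=
  ¬ ∃ y : List α, y <:+: w ∧ y.length = k ∧ ∀ x ∈ y, x ∈ I

/-- The code `S_{I,J}^{(k)}(n)`: words of length `n` whose first `k` coordinates lie
in `I`, whose `(k+1)`-th and `n`-th coordinates lie in `J`, and whose subword from
position `k+2` to `n-1` (1-indexed) is `I^k`-free. -/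
def Sijk {q : ℕ} (I J : Set (Fin q)) (k n : ℕ) : Set (List (Fin q)) :=
  {w | w.length = n ∧ (∀ x ∈ w.take k, x ∈ I) ∧ (∃ a ∈ J, w[k]? = some a) ∧
       (∃ a ∈ J, w[n-1]? = some a) ∧ IkFree I k ((w.drop (k+1)).take (n - k - 2))}

/-- The set `V_{I,J}^{(t)}(m)` (with ambient parameters `n, k`): words of length `m`
whose first `t` coordinates lie in `I`, whose `(t+1)`-th coordinate lies in `J`,
whose `(n-k+t)`-th coordinate lies in `I` when `m > n-k+t`, and whose last
coordinate lies in `J`. -/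
def Vset {q : ℕ} (I J : Set (Fin q)) (n k t m : ℕ) : Set (List (Fin q)) :=
  {w | w.length = m ∧ (∀ x ∈ w.take t, x ∈ I) ∧ (∃ a ∈ J, w[t]? = some a) ∧
       (n - k + t < m → ∃ a ∈ I, w[n - k + t - 1]? = some a) ∧
       (∃ a ∈ J, w[m - 1]? = some a)}

/-- The set `U_{I,J}^{(t)}(m)`: words of `V_{I,J}^{(t)}(m)` whose suffix of length `ℓ`
does not belong to `V_{I,J}^{(t)}(ℓ)` for all `t+1 ≤ ℓ ≤ m-(t+1)` with `ℓ ≠ n-k+t`. -/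
def Uset {q : ℕ} (I J : Set (Fin q)) (n k t m : ℕ) : Set (List (Fin q)) :=
  {w | w ∈ Vset I J n k t m ∧ ∀ ℓ : ℕ, t + 1 ≤ ℓ → ℓ + (t + 1) ≤ m → ℓ ≠ n - k + t →
       w.drop (m - ℓ) ∉ Vset I J n k t ℓ}


theorem stmt18_eq {q : ℕ} (I J : Set (Fin q)) :
    Uset I J 7 5 2 7 =
      (fun p : Fin q × Fin q × Fin q × Fin q × (Fin q × Fin q) × Fin q =>
        [p.1, p.2.1, p.2.2.1, p.2.2.2.1, p.2.2.2.2.1.1, p.2.2.2.2.1.2, p.2.2.2.2.2]) ''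
      (I ×ˢ I ×ˢ J ×ˢ I ×ˢ (I ×ˢ I)ᶜ ×ˢ J) := by
  ext w
  constructor
  · rintro ⟨⟨hl, h1, h2, h3, h4⟩, h5⟩
    have h6 := h5 3 (by norm_num) (by norm_num) (by norm_num)
    match w, hl with
    | [a, b, c, d, e, f, g], _ =>
      simp [Vset] at h1 h2 h3 h4 h6
      refine ⟨(a, b, c, d, (e, f), g), ?_, rfl⟩
      simp only [Set.mem_prod, Set.mem_compl_iff]
      tauto
  · rintro ⟨⟨a, b, c, d, ⟨e, f⟩, g⟩, hp, rfl⟩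
    simp only [Set.mem_prod, Set.mem_compl_iff] at hp
    refine ⟨?_, ?_⟩
    · simp [Vset]
      tauto
    · intro l h1 h2 h3
      obtain rfl : l = 3 := by omega
      simp [Vset]
      tauto

theorem stmt18 (q : ℕ) (hq : 1 < q)
    (I J : Set (Fin q)) (hIJ : I ∪ J = Set.univ) (hd : I ∩ J = ∅)
    (hI : I.Nonempty) (hJ : J.Nonempty) :
    ((Uset I J 7 5 2 7).ncard : ℤ) =
      (I.ncard : ℤ) ^ 3 * (J.ncard : ℤ) ^ 2 * ((q : ℤ) ^ 2 - (I.ncard : ℤ) ^ 2) := by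
  have hc := Set.ncard_add_ncard_compl (I ×ˢ I)
  rw [Set.ncard_prod, Nat.card_prod, Nat.card_fin] at hc
  rw [stmt18_eq, Set.ncard_image_of_injective]
  · simp only [Set.ncard_prod]
    have hc' : (((I ×ˢ I)ᶜ : Set (Fin q × Fin q)).ncard : ℤ)
        = (q : ℤ) ^ 2 - (I.ncard : ℤ) ^ 2 := by
      zify at hc
      linarith
    push_cast
    rw [hc']
    ring
  · rintro ⟨a, b, c, d, ⟨e, f⟩, g⟩ ⟨a', b', c', d', ⟨e', f'⟩, g'⟩ h
    simpa [and_assoc] using h
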